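/- The number of popular matchings in a bipartite instance with w(a) = c > 3 for all a ∈ A and w(b) = 1 for all b ∈ B is at most 2^{n/4}, where n is the total number of vertices. -/

import Mathlib

structure PMInstance (V : Type) [Fintype V] [DecidableEq V] where
  A : Finset V
  E : V → V → Prop
  Esymm : ∀ u v : V, E u v → E v u
  loopless : ∀ v : V, ¬ E v v
  bipartite : ∀ u v : V, E u v → (u ∈ A ↔ v ∉ A)
  pref : V → V → V → Prop
  pref_irrefl : ∀ v u : V, ¬ pref v u u
  pref_trans : ∀ v u z t : V, pref v u z → pref v z t → pref v u t
  pref_asymm : ∀ v u z : V, pref v u z → ¬ pref v z u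
  pref_total : ∀ v u z : V, E v u → E v z → u ≠ z → pref v u z ∨ pref v z u
  w : V → ℚ
  w_nonneg : ∀ v : V, 0 ≤ w v

structure Matching (V : Type) [Fintype V] [DecidableEq V] (E : V → V → Prop) where
  m : V → Option V
  msymm : ∀ u v : V, m u = some v ↔ m v = some u
  valid : ∀ u v : V, m u = some v → E u v

attribute [local instance] Classical.propDecidable

variable {V : Type} [Fintype V] [DecidableEq V]

/-- Vertex `v` prefers matching `M` to matching `M'`. -/
def prefersVx (I : PMInstance V) (M M' : Matching V I.E) (v : V) : Prop :=
  (M'.m v = none ∧ M.m v ≠ none) ∨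
    (∃ u u' : V, M.m v = some u ∧ M'.m v = some u' ∧ I.pref v u u')

/-- Total weight of the vertices preferring `M` to `M'`. -/
noncomputable def weightPref (I : PMInstance V) (M M' : Matching V I.E) : ℚ :=
  ∑ v : V, if prefersVx I M M' v then I.w v else 0

/-- A matching is popular if it never loses a weighted head-to-head comparison. -/
def popular (I : PMInstance V) (M : Matching V I.E) : Prop :=
  ∀ M' : Matching V I.E, weightPref I M' M ≤ weightPref I M M'

section Orientation

variable {W : Type*}

/-- A choice `g` of one of the two endpoints `f a`, `s a` for every `a ∈ A`, no endpoint being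
chosen twice, such that every value of `f` is chosen by some `a` having it as its `f`-endpoint. -/
structure IsOrientation (A : Finset W) (f s g : W → W) : Prop where
  mem : ∀ a ∈ A, g a = f a ∨ g a = s a
  inj : ∀ a ∈ A, ∀ a' ∈ A, g a = g a' → a = a'
  top : ∀ a ∈ A, ∃ a' ∈ A, g a' = f a ∧ f a' = f a

/-- Connectedness by the edges joining `f a` to `s a` for `a ∈ A`. -/
def linkSetoid (A : Finset W) (f s : W → W) : Setoid W :=
  Relation.EqvGen.setoid fun u v => ∃ a ∈ A, f a = u ∧ s a = v

/-- The connected component of a vertex. -/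
def linkClass (A : Finset W) (f s : W → W) (v : W) : Quotient (linkSetoid A f s) :=
  Quotient.mk _ v

/-- The vertex `v` is not chosen by `g`. -/
def IsFree (A : Finset W) (g : W → W) (v : W) : Prop := ∀ a ∈ A, g a ≠ v

/-- The vertex `v` is chosen differently by `g` and `h`. -/
def Differs (A : Finset W) (g h : W → W) (v : W) : Prop :=
  (∃ a ∈ A, g a = v ∧ h a ≠ v) ∨ ∃ a ∈ A, h a = v ∧ g a ≠ v

/-- The other endpoint of the edge choosing `v`, or `v` itself if there is none. -/
noncomputable def otherEnd (A : Finset W) (f s g : W → W) (v : W) : W :=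
  if h : ∃ a ∈ A, g a = v then (if f h.choose = v then s h.choose else f h.choose) else v

/-- The edges of a connected component. -/
noncomputable def classEdges (A : Finset W) (f s : W → W) (K : Quotient (linkSetoid A f s)) :
    Finset W :=
  A.filter fun a => linkClass A f s (f a) = K

variable {A : Finset W} {f s g h k : W → W}

theorem linkClass_eq {a : W} (ha : a ∈ A) : linkClass A f s (f a) = linkClass A f s (s a) :=
  Quotient.sound (s := linkSetoid A f s) (Relation.EqvGen.rel _ _ ⟨a, ha, rfl, rfl⟩)

theorem mem_classEdges {K : Quotient (linkSetoid A f s)} {a : W} :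
    a ∈ classEdges A f s K ↔ a ∈ A ∧ linkClass A f s (f a) = K := by
  simp [classEdges]

theorem Differs.symm {v : W} (hv : Differs A g h v) : Differs A h g v := Or.symm hv

namespace IsOrientation

theorem linkClass_eq (hg : IsOrientation A f s g) {a : W} (ha : a ∈ A) :
    linkClass A f s (g a) = linkClass A f s (f a) := by
  rcases hg.mem a ha with e | e <;> rw [e]
  exact (_root_.linkClass_eq ha).symm

theorem otherEnd_apply (hg : IsOrientation A f s g) {a : W} (ha : a ∈ A) :
    otherEnd A f s g (g a) = if f a = g a then s a else f a := by
  have hex : ∃ b ∈ A, g b = g a := ⟨a, ha, rfl⟩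
  have : hex.choose = a := hg.inj _ hex.choose_spec.1 _ ha hex.choose_spec.2
  simp only [otherEnd, dif_pos hex, this]

theorem otherEnd_of_isFree {v : W} (hv : IsFree A g v) : otherEnd A f s g v = v := by
  have : ¬ ∃ b ∈ A, g b = v := by
    rintro ⟨b, hb, e⟩
    exact hv b hb e
  simp only [otherEnd, dif_neg this]

theorem iterate_of_isFree {v : W} (hv : IsFree A g v) (n : ℕ) :
    (otherEnd A f s g)^[n] v = v :=
  Function.iterate_fixed (otherEnd_of_isFree hv) n

theorem otherEnd_eq (hg : IsOrientation A f s g) (hh : IsOrientation A f s h) {a : W}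
    (ha : a ∈ A) (hne : g a ≠ h a) : otherEnd A f s g (g a) = h a := by
  rw [hg.otherEnd_apply ha]
  have h1 := hg.mem a ha
  have h2 := hh.mem a ha
  grind

theorem exists_iterate_eq (hg : IsOrientation A f s g) {v w : W}
    (e : linkClass A f s v = linkClass A f s w) :
    ∃ i j, (otherEnd A f s g)^[i] v = (otherEnd A f s g)^[j] w := by
  have hr : Relation.EqvGen (fun u v => ∃ a ∈ A, f a = u ∧ s a = v) v w :=
    Quotient.exact (s := linkSetoid A f s) e
  clear e
  induction hr with
  | rel x y hxy =>
    obtain ⟨a, ha, rfl, rfl⟩ := hxy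
    have hp := hg.otherEnd_apply ha
    by_cases hfs : f a = s a
    · exact ⟨0, 0, by simp [hfs]⟩
    · rcases hg.mem a ha with e | e
      · refine ⟨1, 0, ?_⟩
        rw [e] at hp
        simpa using hp
      · refine ⟨0, 1, ?_⟩
        rw [e, if_neg hfs] at hp
        simpa using hp.symm
  | refl x => exact ⟨0, 0, rfl⟩
  | symm x y _ ih =>
    obtain ⟨i, j, e⟩ := ih
    exact ⟨j, i, e.symm⟩
  | trans x y z _ _ ih₁ ih₂ =>
    obtain ⟨i, j, e₁⟩ := ih₁
    obtain ⟨i', j', e₂⟩ := ih₂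
    refine ⟨i' + i, j + j', ?_⟩
    rw [Function.iterate_add_apply, e₁, ← Function.iterate_add_apply, add_comm,
      Function.iterate_add_apply, e₂, ← Function.iterate_add_apply]

theorem isFree_unique (hg : IsOrientation A f s g) {v w : W} (hv : IsFree A g v)
    (hw : IsFree A g w) (e : linkClass A f s v = linkClass A f s w) : v = w := by
  obtain ⟨i, j, hij⟩ := hg.exists_iterate_eq e
  rwa [iterate_of_isFree hv, iterate_of_isFree hw] at hij

theorem ne_of_differs (hg : IsOrientation A f s g) (hh : IsOrientation A f s h) {a : W}
    (ha : a ∈ A) (hv : Differs A g h (g a)) : h a ≠ g a := by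
  rcases hv with ⟨b, hb, e, hne⟩ | ⟨b, hb, e, hne⟩
  · obtain rfl := hg.inj _ hb _ ha e
    exact hne
  · intro e'
    obtain rfl := hh.inj _ hb _ ha (e.trans e'.symm)
    exact hne rfl

theorem differs_otherEnd (hg : IsOrientation A f s g) (hh : IsOrientation A f s h) {v : W}
    (hv : Differs A g h v) : Differs A g h (otherEnd A f s g v) := by
  by_cases hfree : IsFree A g v
  · rwa [otherEnd_of_isFree hfree]
  · simp only [IsFree, not_forall, not_not] at hfree
    obtain ⟨a, ha, rfl⟩ := hfree
    have hne := hg.ne_of_differs hh ha hv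
    rw [hg.otherEnd_eq hh ha hne.symm]
    exact Or.inr ⟨a, ha, rfl, hne.symm⟩

theorem differs_iterate (hg : IsOrientation A f s g) (hh : IsOrientation A f s h) {v : W}
    (hv : Differs A g h v) (n : ℕ) : Differs A g h ((otherEnd A f s g)^[n] v) := by
  induction n with
  | zero => exact hv
  | succ n ih =>
    rw [Function.iterate_succ_apply']
    exact hg.differs_otherEnd hh ih

theorem eq_of_isFree (hg : IsOrientation A f s g) (hh : IsOrientation A f s h) {r a : W}
    (hr : IsFree A g r) (hr' : IsFree A h r) (ha : a ∈ A)
    (e : linkClass A f s (f a) = linkClass A f s r) : g a = h a := by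
  by_contra hne
  have hd : Differs A g h (g a) := Or.inl ⟨a, ha, rfl, Ne.symm hne⟩
  obtain ⟨i, j, hij⟩ := hg.exists_iterate_eq ((hg.linkClass_eq ha).trans e)
  have := hg.differs_iterate hh hd i
  rw [hij, iterate_of_isFree hr] at this
  rcases this with ⟨b, hb, e, -⟩ | ⟨b, hb, e, -⟩
  · exact hr b hb e
  · exact hr' b hb e

theorem linkClass_otherEnd (hg : IsOrientation A f s g) (v : W) :
    linkClass A f s (otherEnd A f s g v) = linkClass A f s v := by
  by_cases hfree : IsFree A g v
  · rw [otherEnd_of_isFree hfree]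
  · simp only [IsFree, not_forall, not_not] at hfree
    obtain ⟨a, ha, rfl⟩ := hfree
    rw [hg.otherEnd_apply ha, hg.linkClass_eq ha]
    split_ifs
    · exact (_root_.linkClass_eq ha).symm
    · rfl

theorem mem_periodicPts [Finite W] (hg : IsOrientation A f s g) (hh : IsOrientation A f s h) {v : W}
    (hfree : ∀ r, linkClass A f s r = linkClass A f s v → ¬ IsFree A g r)
    (hv : Differs A g h v) : ∃ n, 0 < n ∧ (otherEnd A f s g)^[n] v = v := by
  let S : Set W := {u | Differs A g h u ∧ linkClass A f s u = linkClass A f s v}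
  have hS : Set.MapsTo (otherEnd A f s g) S S := fun u hu =>
    ⟨hg.differs_otherEnd hh hu.1, (hg.linkClass_otherEnd u).trans hu.2⟩
  have key : ∀ u ∈ S, ∃ a ∈ A, g a = u ∧ otherEnd A f s g u = h a := by
    rintro u ⟨hu, hc⟩
    have := hfree u hc
    simp only [IsFree, not_forall, not_not] at this
    obtain ⟨a, ha, rfl⟩ := this
    exact ⟨a, ha, rfl, hg.otherEnd_eq hh ha (hg.ne_of_differs hh ha hu).symm⟩
  have hinj : Function.Injective (hS.restrict) := by
    rintro ⟨u, hu⟩ ⟨u', hu'⟩ e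
    obtain ⟨a, ha, rfl, e₁⟩ := key u hu
    obtain ⟨a', ha', rfl, e₂⟩ := key u' hu'
    have e' : otherEnd A f s g (g a) = otherEnd A f s g (g a') := congrArg Subtype.val e
    rw [e₁, e₂] at e'
    have := hh.inj a ha a' ha' e'
    subst this
    rfl
  obtain ⟨n, hn, hp⟩ := hinj.mem_periodicPts ⟨v, hv, rfl⟩
  refine ⟨n, hn, ?_⟩
  have := congrArg Subtype.val hp.eq
  rwa [hS.iterate_restrict n] at this

theorem differs_of_differs [Finite W] (hg : IsOrientation A f s g) (hh : IsOrientation A f s h)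
    (hk : IsOrientation A f s k) {v w : W}
    (hfree : ∀ r, linkClass A f s r = linkClass A f s v → ¬ IsFree A g r)
    (hv : Differs A g h v) (hw : Differs A g k w)
    (e : linkClass A f s v = linkClass A f s w) : Differs A g k v := by
  obtain ⟨i, j, hij⟩ := hg.exists_iterate_eq e
  obtain ⟨n, hn, hp⟩ := hg.mem_periodicPts hh hfree hv
  have hp' : (otherEnd A f s g)^[n * i] v = v := by
    rw [Function.iterate_mul]
    exact Function.iterate_fixed hp i
  have hle : i ≤ n * i := Nat.le_mul_of_pos_left i hn
  rw [← Nat.sub_add_cancel hle, Function.iterate_add_apply, hij,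
    ← Function.iterate_add_apply] at hp'
  rw [← hp']
  exact hg.differs_iterate hk hw _

/-- In a component without free vertices there are at most two orientations. -/
theorem eq_of_ne_of_ne [Finite W] (hg : IsOrientation A f s g) (hh : IsOrientation A f s h)
    (hk : IsOrientation A f s k) {K : Quotient (linkSetoid A f s)}
    (hfree : ∀ r, linkClass A f s r = K → ¬ IsFree A g r)
    {b c : W} (hb : b ∈ classEdges A f s K) (hgh : g b ≠ h b)
    (hc : c ∈ classEdges A f s K) (hgk : g c ≠ k c) {a : W} (ha : a ∈ classEdges A f s K) :
    h a = k a := by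
  rw [mem_classEdges] at ha hb hc
  have hdb : Differs A g h (g b) := Or.inl ⟨b, hb.1, rfl, hgh.symm⟩
  have hdc : Differs A g k (g c) := Or.inl ⟨c, hc.1, rfl, hgk.symm⟩
  have hcl : ∀ x, x ∈ A ∧ linkClass A f s (f x) = K → linkClass A f s (g x) = K :=
    fun x hx => (hg.linkClass_eq hx.1).trans hx.2
  have h1 : g a ≠ h a → g a ≠ k a := fun hne => by
    have hd : Differs A g h (g a) := Or.inl ⟨a, ha.1, rfl, hne.symm⟩
    exact (hg.ne_of_differs hk ha.1 (hg.differs_of_differs hh hk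
      (fun r hr => hfree r (hr.trans (hcl a ha))) hd hdc
      ((hcl a ha).trans (hcl c hc).symm))).symm
  have h2 : g a ≠ k a → g a ≠ h a := fun hne => by
    have hd : Differs A g k (g a) := Or.inl ⟨a, ha.1, rfl, hne.symm⟩
    exact (hg.ne_of_differs hh ha.1 (hg.differs_of_differs hk hh
      (fun r hr => hfree r (hr.trans (hcl a ha))) hd hdb
      ((hcl a ha).trans (hcl b hb).symm))).symm
  have := hg.mem a ha.1
  have := hh.mem a ha.1
  have := hk.mem a ha.1
  grind

theorem card_filter_eq (hg : IsOrientation A f s g) (K : Quotient (linkSetoid A f s)) :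
    ((classEdges A f s K).filter fun a => g a = f a).card =
      ((classEdges A f s K).image f).card := by
  rw [← Finset.card_image_of_injOn (f := g)]
  · congr 1
    ext v
    simp only [Finset.mem_image, Finset.mem_filter, mem_classEdges]
    constructor
    · rintro ⟨a, ⟨ha, e⟩, rfl⟩
      exact ⟨a, ha, e.symm⟩
    · rintro ⟨a, ⟨ha, e⟩, rfl⟩
      obtain ⟨b, hb, e₁, e₂⟩ := hg.top a ha
      exact ⟨b, ⟨⟨hb, by rwa [e₂]⟩, by rw [e₁, e₂]⟩, e₁⟩
  · intro a ha b hb e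
    simp only [Finset.coe_filter, mem_classEdges, Set.mem_ofPred_eq] at ha hb
    exact hg.inj a ha.1.1 b hb.1.1 e

/-- Among the edges on which two orientations differ, equally many choose their `f`-endpoint in
either of them. -/
theorem card_filter_top_eq (hg : IsOrientation A f s g) (hh : IsOrientation A f s h)
    (K : Quotient (linkSetoid A f s)) :
    ((classEdges A f s K).filter fun a => g a ≠ h a ∧ g a = f a).card =
      ((classEdges A f s K).filter fun a => g a ≠ h a ∧ h a = f a).card := by
  have h1 := hg.card_filter_eq K
  rw [← hh.card_filter_eq K,
    ← Finset.card_filter_add_card_filter_not (s := (classEdges A f s K).filter fun a => g a = f a)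
      (fun a => g a = h a),
    ← Finset.card_filter_add_card_filter_not (s := (classEdges A f s K).filter fun a => h a = f a)
      (fun a => g a = h a)] at h1
  simp only [Finset.filter_filter] at h1
  have h2 : (classEdges A f s K).filter (fun a => g a = f a ∧ g a = h a) =
      (classEdges A f s K).filter (fun a => h a = f a ∧ g a = h a) := by
    apply Finset.filter_congr
    grind
  rw [h2] at h1
  have h3 := Nat.add_left_cancel h1
  simp only [and_comm] at h3 ⊢
  exact h3

theorem even_card_ne (hg : IsOrientation A f s g) (hh : IsOrientation A f s h)
    (K : Quotient (linkSetoid A f s)) :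
    Even ((classEdges A f s K).filter fun a => g a ≠ h a).card := by
  refine ⟨((classEdges A f s K).filter fun a => g a ≠ h a ∧ g a = f a).card, ?_⟩
  nth_rewrite 2 [hg.card_filter_top_eq hh K]
  rw [← Finset.card_union_of_disjoint]
  · congr 1
    ext a
    simp only [Finset.mem_union, Finset.mem_filter, mem_classEdges]
    have := hg.mem a
    have := hh.mem a
    grind
  · rw [Finset.disjoint_left]
    simp only [Finset.mem_filter]
    grind

theorem exists_isFree_iff [Fintype W] (hg : IsOrientation A f s g)
    (K : Quotient (linkSetoid A f s)) :
    (∃ r, linkClass A f s r = K ∧ IsFree A g r) ↔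
      (classEdges A f s K).card ≠ (Finset.univ.filter fun v => linkClass A f s v = K).card := by
  have hsub : (classEdges A f s K).image g ⊆
      Finset.univ.filter fun v => linkClass A f s v = K := by
    intro v hv
    simp only [Finset.mem_image, mem_classEdges] at hv
    obtain ⟨a, ⟨ha, e⟩, rfl⟩ := hv
    simp [hg.linkClass_eq ha, e]
  have hcard : ((classEdges A f s K).image g).card = (classEdges A f s K).card := by
    apply Finset.card_image_of_injOn
    intro a ha b hb e
    simp only [Finset.mem_coe, mem_classEdges] at ha hb
    exact hg.inj a ha.1 b hb.1 e
  rw [← hcard, ← not_iff_not, not_not]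
  constructor
  · intro hno
    congr 1
    refine hsub.antisymm fun v hv => ?_
    simp only [Finset.mem_filter, Finset.mem_univ, true_and] at hv
    have : ¬ IsFree A g v := fun hf => hno ⟨v, hv, hf⟩
    simp only [IsFree, not_forall, not_not] at this
    obtain ⟨a, ha, rfl⟩ := this
    rw [hg.linkClass_eq ha] at hv
    exact Finset.mem_image_of_mem _ (mem_classEdges.2 ⟨ha, hv⟩)
  · rintro hc ⟨r, hr, hf⟩
    have heq := Finset.eq_of_subset_of_card_le hsub hc.ge
    have : r ∈ (classEdges A f s K).image g := by
      rw [heq]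
      simp [hr]
    obtain ⟨a, ha, e⟩ := Finset.mem_image.1 this
    exact hf a (mem_classEdges.1 ha).1 e

/-- If the components' free vertices under two orientations are distinct, then an odd number of
vertices is chosen differently. -/
theorem odd_card_differs [Fintype W] (hg : IsOrientation A f s g) (hh : IsOrientation A f s h)
    {r t : W} (hr : IsFree A g r) (ht : IsFree A h t)
    (hrt : linkClass A f s t = linkClass A f s r) (hne : r ≠ t) :
    Odd (Finset.univ.filter fun v => linkClass A f s v = linkClass A f s r ∧
      Differs A g h v).card := by
  set K := linkClass A f s r
  have hgt : ¬ IsFree A g t := fun hf => hne (hg.isFree_unique hr hf hrt.symm)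
  simp only [IsFree, not_forall, not_not] at hgt
  obtain ⟨b, hb, rfl⟩ := hgt
  have heq : (Finset.univ.filter fun v => linkClass A f s v = K ∧ Differs A g h v) =
      insert (g b) (((classEdges A f s K).filter fun a => g a ≠ h a).image h) := by
    ext v
    simp only [Finset.mem_filter, Finset.mem_univ, true_and, Finset.mem_insert, Finset.mem_image,
      mem_classEdges]
    constructor
    · rintro ⟨hv, hd⟩
      by_cases hf : IsFree A h v
      · exact Or.inl (hh.isFree_unique hf ht (hv.trans hrt.symm))
      · simp only [IsFree, not_forall, not_not] at hf
        obtain ⟨a, ha, rfl⟩ := hf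
        rw [hh.linkClass_eq ha] at hv
        exact Or.inr ⟨a, ⟨⟨ha, hv⟩, hh.ne_of_differs hg ha hd.symm⟩, rfl⟩
    · rintro (rfl | ⟨a, ⟨⟨ha, e⟩, hne'⟩, rfl⟩)
      · exact ⟨hrt, Or.inl ⟨b, hb, rfl, ht b hb⟩⟩
      · exact ⟨(hh.linkClass_eq ha).trans e, Or.inr ⟨a, ha, rfl, hne'⟩⟩
  rw [heq, Finset.card_insert_of_notMem, Finset.card_image_of_injOn]
  · exact (hg.even_card_ne hh K).add_one
  · intro a ha a' ha' e
    simp only [Finset.coe_filter, mem_classEdges, Set.mem_ofPred_eq] at ha ha'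
    exact hh.inj a ha.1.1 a' ha'.1.1 e
  · simp only [Finset.mem_image, Finset.mem_filter, mem_classEdges]
    rintro ⟨a, ⟨⟨ha, -⟩, -⟩, e⟩
    exact ht a ha e

/-- If no edge chooses an edge other than itself, then the vertices chosen differently that are
edges are free vertices. -/
theorem isFree_of_differs (hg : IsOrientation A f s g)
    (hself : ∀ a ∈ A, (f a ∈ A → f a = a) ∧ (s a ∈ A → s a = a)) (hh : IsOrientation A f s h)
    {v : W} (hv : v ∈ A) (hd : Differs A g h v) : IsFree A g v ∨ IsFree A h v := by
  by_contra! hcon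
  simp only [IsFree, not_forall, not_not] at hcon
  obtain ⟨⟨a, ha, rfl⟩, b, hb, e⟩ := hcon
  have hga : g a = a := by
    have := hg.mem a ha
    have := hself a ha
    grind
  have hhb : h b = b := by
    have := hh.mem b hb
    have := hself b hb
    grind
  have : b = a := by rw [← hhb, e, hga]
  subst this
  exact hg.ne_of_differs hh ha hd e

theorem odd_card_differs_notMem [Fintype W] (hg : IsOrientation A f s g)
    (hh : IsOrientation A f s h)
    (hself : ∀ a ∈ A, (f a ∈ A → f a = a) ∧ (s a ∈ A → s a = a))
    {r t : W} (hr : IsFree A g r) (ht : IsFree A h t)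
    (hrt : linkClass A f s t = linkClass A f s r) (hne : r ≠ t) (htype : r ∈ A ↔ t ∈ A) :
    Odd (Finset.univ.filter fun v => v ∉ A ∧ linkClass A f s v = linkClass A f s r ∧
      Differs A g h v).card := by
  have hodd := hg.odd_card_differs hh hr ht hrt hne
  rw [← Finset.card_filter_add_card_filter_not (fun v => v ∈ A), Finset.filter_filter,
    Finset.filter_filter] at hodd
  have hdr : Differs A g h r := by
    by_cases hf : IsFree A h r
    · exact absurd (hh.isFree_unique hf ht hrt.symm) hne
    · simp only [IsFree, not_forall, not_not] at hf
      obtain ⟨a, ha, rfl⟩ := hf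
      exact Or.inr ⟨a, ha, rfl, hr a ha⟩
  have hdt : Differs A g h t := by
    by_cases hf : IsFree A g t
    · exact absurd (hg.isFree_unique hr hf hrt.symm) hne
    · simp only [IsFree, not_forall, not_not] at hf
      obtain ⟨a, ha, rfl⟩ := hf
      exact Or.inl ⟨a, ha, rfl, ht a ha⟩
  have heven : Even (Finset.univ.filter fun v => (linkClass A f s v = linkClass A f s r ∧
      Differs A g h v) ∧ v ∈ A).card := by
    have heq : (Finset.univ.filter fun v => (linkClass A f s v = linkClass A f s r ∧
        Differs A g h v) ∧ v ∈ A) = if r ∈ A then {r, t} else ∅ := by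
      ext v
      simp only [Finset.mem_filter, Finset.mem_univ, true_and]
      have key : (linkClass A f s v = linkClass A f s r ∧ Differs A g h v) ∧ v ∈ A →
          v = r ∨ v = t := by
        rintro ⟨⟨hv, hd⟩, hvA⟩
        rcases hg.isFree_of_differs hself hh hvA hd with hf | hf
        · exact Or.inl (hg.isFree_unique hf hr hv)
        · exact Or.inr (hh.isFree_unique hf ht (hv.trans hrt.symm))
      split_ifs with hrA
      · simp only [Finset.mem_insert, Finset.mem_singleton]
        refine ⟨key, ?_⟩
        rintro (rfl | rfl)
        · exact ⟨⟨rfl, hdr⟩, hrA⟩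
        · exact ⟨⟨hrt, hdt⟩, htype.1 hrA⟩
      · simp only [Finset.notMem_empty, iff_false]
        intro hv
        rcases key hv with rfl | rfl
        · exact hrA hv.2
        · exact hrA (htype.2 hv.2)
    rw [heq]
    split_ifs
    · rw [Finset.card_pair hne]
      exact even_two
    · simp
  have := (Nat.odd_add'.1 hodd).2 heven
  simpa only [and_comm] using this

theorem eq_of_even [Fintype W] (hg : IsOrientation A f s g) (hh : IsOrientation A f s h)
    (hself : ∀ a ∈ A, (f a ∈ A → f a = a) ∧ (s a ∈ A → s a = a))
    {K : Quotient (linkSetoid A f s)}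
    (heven : Even (Finset.univ.filter fun v => v ∉ A ∧ linkClass A f s v = K ∧
      Differs A g h v).card)
    {r t : W} (hr : IsFree A g r) (ht : IsFree A h t) (hrK : linkClass A f s r = K)
    (htK : linkClass A f s t = K) (htype : r ∈ A ↔ t ∈ A) :
    ∀ a ∈ classEdges A f s K, g a = h a := by
  intro a ha
  rw [mem_classEdges] at ha
  subst hrK
  by_cases hne : r = t
  · subst hne
    exact hg.eq_of_isFree hh hr ht ha.1 ha.2
  · exact absurd heven (Nat.not_even_iff_odd.2
      (hg.odd_card_differs_notMem hh hself hr ht htK hne htype))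

/-- Among three orientations, any two of which differ on an even number of the vertices of a
component that are not edges, two agree on that component. -/
theorem agree_of_even [Fintype W] (hg : IsOrientation A f s g) (hh : IsOrientation A f s h)
    (hk : IsOrientation A f s k)
    (hself : ∀ a ∈ A, (f a ∈ A → f a = a) ∧ (s a ∈ A → s a = a))
    {K : Quotient (linkSetoid A f s)}
    (hgh : Even (Finset.univ.filter fun v => v ∉ A ∧ linkClass A f s v = K ∧
      Differs A g h v).card)
    (hgk : Even (Finset.univ.filter fun v => v ∉ A ∧ linkClass A f s v = K ∧
      Differs A g k v).card)
    (hhk : Even (Finset.univ.filter fun v => v ∉ A ∧ linkClass A f s v = K ∧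
      Differs A h k v).card) :
    (∀ a ∈ classEdges A f s K, g a = h a) ∨ (∀ a ∈ classEdges A f s K, g a = k a) ∨
      ∀ a ∈ classEdges A f s K, h a = k a := by
  by_cases hfree : ∃ r, linkClass A f s r = K ∧ IsFree A g r
  · have hfree' := hfree
    have hfree'' := hfree
    rw [hg.exists_isFree_iff K, ← hh.exists_isFree_iff K] at hfree'
    rw [hg.exists_isFree_iff K, ← hk.exists_isFree_iff K] at hfree''
    obtain ⟨r₁, h₁, f₁⟩ := hfree
    obtain ⟨r₂, h₂, f₂⟩ := hfree'
    obtain ⟨r₃, h₃, f₃⟩ := hfree''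
    by_cases h₁₂ : r₁ ∈ A ↔ r₂ ∈ A
    · exact Or.inl (hg.eq_of_even hh hself hgh f₁ f₂ h₁ h₂ h₁₂)
    by_cases h₁₃ : r₁ ∈ A ↔ r₃ ∈ A
    · exact Or.inr (Or.inl (hg.eq_of_even hk hself hgk f₁ f₃ h₁ h₃ h₁₃))
    · exact Or.inr (Or.inr (hh.eq_of_even hk hself hhk f₂ f₃ h₂ h₃ (by tauto)))
  · by_contra! hcon
    obtain ⟨⟨b, hb, hb'⟩, ⟨c, hc, hc'⟩, d, hd, hd'⟩ := hcon
    exact hd' (hg.eq_of_ne_of_ne hh hk (fun r hr hf => hfree ⟨r, hr, hf⟩) hb hb' hc hc' hd)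

end IsOrientation

end Orientation

namespace Matching

variable {E : V → V → Prop}

theorem ext_m {M M' : Matching V E} (h : ∀ v, M.m v = M'.m v) : M = M' := by
  cases M
  cases M'
  congr
  exact funext h

/-- Match `a` with `b`, releasing their former partners. -/
def put (M : Matching V E) (a b : V) (hab : E a b) (hba : E b a) :
    Matching V E where
  m v := if v = a then some b else if v = b then some a else
    if M.m v = some a ∨ M.m v = some b then none else M.m v
  msymm u v := by
    have h1 := M.msymm u v
    have h2 := M.msymm a v
    have h3 := M.msymm b v
    have h4 := M.msymm u a
    have h5 := M.msymm u b
    grind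
  valid u v := by
    have := M.valid u v
    grind

theorem put_left (M : Matching V E) {a b : V} (hab : E a b) (hba : E b a) :
    (M.put a b hab hba).m a = some b := by
  simp [put]

theorem put_of_ne (M : Matching V E) {a b v : V} (hab : E a b) (hba : E b a)
    (ha : v ≠ a) (hb : v ≠ b) (ha' : M.m v ≠ some a) (hb' : M.m v ≠ some b) :
    (M.put a b hab hba).m v = M.m v := by
  simp [put, ha, hb, ha', hb']

end Matching

namespace PMInstance

variable (I : PMInstance V)

theorem notMem_of_E {a b : V} (ha : a ∈ I.A) (hE : I.E a b) : b ∉ I.A :=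
  (I.bipartite a b hE).1 ha

theorem mem_of_E {a b : V} (hb : b ∉ I.A) (hE : I.E b a) : a ∈ I.A := by
  by_contra ha
  exact hb ((I.bipartite b a hE).2 ha)

/-- `b` is the favourite of `a` among the neighbours satisfying `P`. -/
def IsBest (a : V) (P : V → Prop) (b : V) : Prop :=
  I.E a b ∧ P b ∧ ∀ b', I.E a b' → P b' → b' ≠ b → I.pref a b b'

theorem exists_isBest {a : V} {P : V → Prop} (h : ∃ b, I.E a b ∧ P b) : ∃ b, I.IsBest a P b := by
  have key : ∀ S : Finset V, (∀ b ∈ S, I.E a b) → S.Nonempty →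
      ∃ b ∈ S, ∀ b' ∈ S, b' ≠ b → I.pref a b b' := by
    intro S
    induction S using Finset.induction_on with
    | empty => simp
    | insert x S hx ih =>
      intro hS _
      rcases S.eq_empty_or_nonempty with rfl | hne
      · exact ⟨x, by simp⟩
      · obtain ⟨b, hb, hbest⟩ := ih (fun b hb => hS b (Finset.mem_insert_of_mem hb)) hne
        have hxb : x ≠ b := fun e => hx (e ▸ hb)
        rcases I.pref_total a x b (hS x (Finset.mem_insert_self x S))
          (hS b (Finset.mem_insert_of_mem hb)) hxb with hp | hp
        · refine ⟨x, Finset.mem_insert_self x S, fun b' hb' hne' => ?_⟩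
          rcases Finset.mem_insert.1 hb' with rfl | hb'
          · exact absurd rfl hne'
          · by_cases e : b' = b
            · rwa [e]
            · exact I.pref_trans a x b b' hp (hbest b' hb' e)
        · refine ⟨b, Finset.mem_insert_of_mem hb, fun b' hb' hne' => ?_⟩
          rcases Finset.mem_insert.1 hb' with rfl | hb'
          · exact hp
          · exact hbest b' hb' hne'
  obtain ⟨b, hb, hP⟩ := h
  obtain ⟨c, hc, hbest⟩ := key (Finset.univ.filter fun b => I.E a b ∧ P b)
    (by simp +contextual) ⟨b, by simp [hb, hP]⟩
  simp only [Finset.mem_filter, Finset.mem_univ, true_and] at hc hbest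
  exact ⟨c, hc.1, hc.2, fun b' h1 h2 => hbest b' ⟨h1, h2⟩⟩

/-- The favourite neighbour of `a` satisfying `P`, or `a` itself if there is none. -/
noncomputable def best (a : V) (P : V → Prop) : V :=
  if h : ∃ b, I.IsBest a P b then h.choose else a

theorem best_spec {a : V} {P : V → Prop} (h : ∃ b, I.E a b ∧ P b) : I.IsBest a P (I.best a P) := by
  have hex := I.exists_isBest h
  rw [best, dif_pos hex]
  exact hex.choose_spec

theorem best_eq_self {a : V} {P : V → Prop} (h : ¬ ∃ b, I.E a b ∧ P b) : I.best a P = a := by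
  rw [best, dif_neg]
  rintro ⟨b, hb⟩
  exact h ⟨b, hb.1, hb.2.1⟩

/-- The favourite neighbour of `a`. -/
noncomputable def first (a : V) : V := I.best a fun _ => True

/-- The favourite among the neighbours of `a` that are nobody's favourite. -/
noncomputable def second (a : V) : V := I.best a fun b => ∀ a' ∈ I.A, I.first a' ≠ b

theorem first_spec {a b : V} (h : I.E a b) :
    I.E a (I.first a) ∧ (b ≠ I.first a → I.pref a (I.first a) b) := by
  have := I.best_spec (P := fun _ => True) ⟨b, h, trivial⟩
  exact ⟨this.1, this.2.2 b h trivial⟩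

theorem self_of_mem {a : V} (ha : a ∈ I.A) (P : V → Prop) (h : I.best a P ∈ I.A) :
    I.best a P = a := by
  by_cases hex : ∃ b, I.E a b ∧ P b
  · exact absurd h (I.notMem_of_E ha (I.best_spec hex).1)
  · exact I.best_eq_self hex

end PMInstance

section Popular

variable {I : PMInstance V} {M M' : Matching V I.E} {c : ℚ}

theorem sum_le_weightPref {S : Finset V} (hS : ∀ v ∈ S, prefersVx I M M' v) :
    ∑ v ∈ S, I.w v ≤ weightPref I M M' := by
  rw [weightPref, ← Finset.sum_filter]
  refine Finset.sum_le_sum_of_subset_of_nonneg (fun v hv => ?_) fun v _ _ => I.w_nonneg v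
  simpa using hS v hv

theorem weightPref_le_sum {S : Finset V} (hS : ∀ v, prefersVx I M M' v → v ∈ S) :
    weightPref I M M' ≤ ∑ v ∈ S, I.w v := by
  rw [weightPref, ← Finset.sum_filter]
  refine Finset.sum_le_sum_of_subset_of_nonneg (fun v hv => ?_) fun v _ _ => I.w_nonneg v
  exact hS v (by simpa using hv)

theorem not_prefersVx_of_eq {v : V} (h : M.m v = M'.m v) : ¬ prefersVx I M M' v := by
  rintro (⟨h1, h2⟩ | ⟨u, u', h1, h2, h3⟩)
  · exact h2 (h.trans h1)
  · rw [h, h2, Option.some_inj] at h1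
    subst h1
    exact I.pref_irrefl _ _ h3

theorem prefersVx_asymm {v : V} (h : prefersVx I M M' v) : ¬ prefersVx I M' M v := by
  rintro (⟨h1, h2⟩ | ⟨u, u', h1, h2, h3⟩)
  · rcases h with ⟨h4, h5⟩ | ⟨w, w', h4, h5, h6⟩
    · exact h5 h1
    · simp [h1] at h4
  · rcases h with ⟨h4, h5⟩ | ⟨w, w', h4, h5, h6⟩
    · simp [h1] at h4
    · rw [h2, Option.some_inj] at h4
      rw [h1, Option.some_inj] at h5
      subst h4 h5
      exact I.pref_asymm _ _ _ h3 h6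

theorem prefersVx_or_of_ne {v : V} (h : M.m v ≠ M'.m v) :
    prefersVx I M M' v ∨ prefersVx I M' M v := by
  rcases h1 : M.m v with _ | u
  · exact Or.inr (Or.inl ⟨h1, fun h2 => h (h1.trans h2.symm)⟩)
  · rcases h2 : M'.m v with _ | u'
    · exact Or.inl (Or.inl ⟨h2, by simp [h1]⟩)
    · have hne : u ≠ u' := by
        rintro rfl
        exact h (h1.trans h2.symm)
      rcases I.pref_total v u u' (M.valid v u h1) (M'.valid v u' h2) hne with hp | hp
      · exact Or.inl (Or.inr ⟨u, u', h1, h2, hp⟩)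
      · exact Or.inr (Or.inr ⟨u', u, h2, h1, hp⟩)

/-- In a popular matching, everybody a vertex of `A` would rather have is matched to somebody
whose favourite they are. -/
theorem popular.first_of_prefers (hM : popular I M) (hc : 3 < c) (hA : ∀ a ∈ I.A, I.w a = c)
    (hB : ∀ b : V, b ∉ I.A → I.w b = 1) {a b : V} (ha : a ∈ I.A) (hab : I.E a b)
    (hp : M.m a = none ∨ ∃ x, M.m a = some x ∧ I.pref a b x) :
    ∃ a' ∈ I.A, M.m b = some a' ∧ I.first a' = b := by
  have hb : b ∉ I.A := I.notMem_of_E ha hab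
  have hba := I.Esymm _ _ hab
  set M₁ := M.put a b hab hba
  have hMa : M.m a ≠ some b := by
    rintro e
    rcases hp with h | ⟨x, h, h'⟩
    · simp [h] at e
    · rw [h, Option.some_inj] at e
      subst e
      exact I.pref_irrefl _ _ h'
  have hgain : ∀ N : Matching V I.E, N.m a = some b → prefersVx I N M a := by
    intro N hN
    rcases hp with h | ⟨x, h, h'⟩
    · exact Or.inl ⟨h, by simp [hN]⟩
    · exact Or.inr ⟨b, x, hN, h, h'⟩
  obtain ⟨S, hSc, hSm⟩ : ∃ S : Finset V, ∑ v ∈ S, I.w v ≤ 1 ∧ ∀ v, M.m v = some a → v ∈ S := by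
    rcases h : M.m a with _ | x
    · refine ⟨∅, by simp, fun v hv => ?_⟩
      rw [M.msymm, h] at hv
      simp at hv
    · refine ⟨{x}, ?_, fun v hv => ?_⟩
      · rw [Finset.sum_singleton, hB x (I.notMem_of_E ha (M.valid a x h))]
      · rw [M.msymm, h, Option.some_inj] at hv
        simp [hv]
  rcases hMb : M.m b with _ | a'
  · exfalso
    have h1 := sum_le_weightPref (I := I) (M := M₁) (M' := M) (S := {a})
      (by simpa using hgain M₁ (M.put_left hab hba))
    have h2 := weightPref_le_sum (I := I) (M := M) (M' := M₁) (S := S) (by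
      intro v hv
      by_contra hvS
      have hva : v ≠ a := by
        rintro rfl
        exact prefersVx_asymm hv (hgain M₁ (M.put_left hab hba))
      have hvb : v ≠ b := by
        rintro rfl
        rcases hv with ⟨-, h⟩ | ⟨u, u', h, -⟩
        · exact h hMb
        · simp [hMb] at h
      refine not_prefersVx_of_eq ?_ hv
      refine (M.put_of_ne hab hba hva hvb (fun h => hvS (hSm v h)) fun h => ?_).symm
      rw [M.msymm, hMb] at h
      simp at h)
    have h3 := hM M₁
    rw [Finset.sum_singleton, hA a ha] at h1
    linarith
  · have hba' := M.valid b a' hMb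
    have ha' := I.mem_of_E hb hba'
    refine ⟨a', ha', rfl, ?_⟩
    by_contra hfb
    obtain ⟨hE', hpf⟩ := I.first_spec (I.Esymm _ _ hba')
    specialize hpf (Ne.symm hfb)
    set d := I.first a'
    have hdB : d ∉ I.A := I.notMem_of_E ha' hE'
    have haa' : a ≠ a' := by
      rintro rfl
      exact hMa ((M.msymm _ _).1 hMb)
    set M₂ := M₁.put a' d hE' (I.Esymm _ _ hE')
    have h2a : M₂.m a = some b := by
      have h1a : M₁.m a = some b := M.put_left hab hba
      rw [← h1a]
      apply M₁.put_of_ne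
      · exact haa'
      · exact fun e => hdB (e ▸ ha)
      · rw [h1a]
        simpa using fun e : b = a' => hb (e ▸ ha')
      · rw [h1a]
        simpa using fun e : b = d => hfb e.symm
    have hgain' : prefersVx I M₂ M a' :=
      Or.inr ⟨d, b, M₁.put_left _ _, (M.msymm _ _).1 hMb, hpf⟩
    obtain ⟨T, hTc, hTm⟩ : ∃ T : Finset V, ∑ v ∈ T, I.w v ≤ c ∧ ∀ v, M.m v = some d → v ∈ T := by
      rcases h : M.m d with _ | x
      · refine ⟨∅, by simp; linarith, fun v hv => ?_⟩
        rw [M.msymm, h] at hv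
        simp at hv
      · refine ⟨{x}, ?_, fun v hv => ?_⟩
        · rw [Finset.sum_singleton, hA x (I.mem_of_E hdB (M.valid d x h))]
        · rw [M.msymm, h, Option.some_inj] at hv
          simp [hv]
    have h1 := sum_le_weightPref (I := I) (M := M₂) (M' := M) (S := {a, a'}) (by
      intro v hv
      simp only [Finset.mem_insert, Finset.mem_singleton] at hv
      rcases hv with rfl | rfl
      · exact hgain M₂ h2a
      · exact hgain')
    have h2 := weightPref_le_sum (I := I) (M := M) (M' := M₂) (S := {b, d} ∪ (S ∪ T)) (by
      intro v hv
      by_contra hvS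
      simp only [Finset.mem_union, Finset.mem_insert, Finset.mem_singleton, not_or] at hvS
      obtain ⟨⟨hvb, hvd⟩, hvS, hvT⟩ := hvS
      have hva : v ≠ a := by
        rintro rfl
        exact prefersVx_asymm hv (hgain M₂ h2a)
      have hva' : v ≠ a' := by
        rintro rfl
        exact prefersVx_asymm hv hgain'
      have e₁ : M₁.m v = M.m v := by
        refine M.put_of_ne hab hba hva hvb (fun h => hvS (hSm v h)) fun h => hva' ?_
        rw [M.msymm, hMb, Option.some_inj] at h
        exact h.symm
      have e₂ : M₂.m v = M₁.m v := by
        refine M₁.put_of_ne _ _ hva' hvd (fun h => hvb ?_) fun h => hvT (hTm v (e₁ ▸ h))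
        rw [e₁, M.msymm, (M.msymm _ _).1 hMb, Option.some_inj] at h
        exact h.symm
      exact not_prefersVx_of_eq (e₂.trans e₁).symm hv)
    have h3 := hM M₂
    have hunion : ∀ X Y : Finset V, ∑ v ∈ X ∪ Y, I.w v ≤ ∑ v ∈ X, I.w v + ∑ v ∈ Y, I.w v := by
      intro X Y
      rw [← Finset.sum_union_inter]
      exact le_add_of_nonneg_right (Finset.sum_nonneg fun v _ => I.w_nonneg v)
    have h4 := hunion {b, d} (S ∪ T)
    have h5 := hunion S T
    rw [Finset.sum_pair haa', hA a ha, hA a' ha'] at h1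
    rw [Finset.sum_pair (Ne.symm hfb), hB b hb, hB d hdB] at h4
    linarith

/-- The partner of a vertex, or the vertex itself if it is unmatched. -/
def Matching.partner {E : V → V → Prop} (M : Matching V E) (a : V) : V := (M.m a).getD a

theorem Matching.partner_eq_iff {b a : V} (hb : b ∉ I.A) (ha : a ∈ I.A) :
    M.partner a = b ↔ M.m b = some a := by
  rw [Matching.partner, ← M.msymm]
  rcases h : M.m a with _ | x
  · simpa using fun e : a = b => hb (e ▸ ha)
  · simp

theorem Matching.partner_ne_iff {a : V} : M.partner a ≠ M'.partner a ↔ M.m a ≠ M'.m a := by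
  rw [Matching.partner, Matching.partner]
  rcases h : M.m a with _ | x <;> rcases h' : M'.m a with _ | y
  · simp
  · simpa using fun e : a = y => I.loopless a (M'.valid a a (e ▸ h'))
  · simpa using fun e : x = a => I.loopless a (M.valid a a (e ▸ h))
  · simp

theorem popular.isOrientation (hM : popular I M) (hc : 3 < c) (hA : ∀ a ∈ I.A, I.w a = c)
    (hB : ∀ b : V, b ∉ I.A → I.w b = 1) :
    IsOrientation I.A I.first I.second M.partner := by
  have hinj : ∀ a ∈ I.A, ∀ a' ∈ I.A, M.partner a = M.partner a' → a = a' := by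
    intro a ha a' ha' e
    by_cases hb : M.partner a ∈ I.A
    · have key : ∀ x ∈ I.A, M.partner x ∈ I.A → M.partner x = x := by
        intro x hx hx'
        rw [Matching.partner] at hx' ⊢
        rcases h : M.m x with _ | y
        · rfl
        · rw [h] at hx'
          exact absurd hx' (I.notMem_of_E hx (M.valid x y h))
      rw [← key a ha hb, e, key a' ha' (e ▸ hb)]
    · have h1 := (Matching.partner_eq_iff hb ha).1 rfl
      have h2 := (Matching.partner_eq_iff hb ha').1 e.symm
      rwa [h1, Option.some_inj] at h2
  have htop : ∀ a ∈ I.A, ∃ a' ∈ I.A, M.partner a' = I.first a ∧ I.first a' = I.first a := by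
    intro a ha
    by_cases hex : ∃ b, I.E a b
    · obtain ⟨b, hb⟩ := hex
      have hE := (I.first_spec hb).1
      by_cases hMa : M.m a = some (I.first a)
      · exact ⟨a, ha, by simp [Matching.partner, hMa], rfl⟩
      · obtain ⟨a', ha', h1, h2⟩ := hM.first_of_prefers hc hA hB ha hE (by
          rcases h : M.m a with _ | x
          · exact Or.inl rfl
          · refine Or.inr ⟨x, rfl, (I.first_spec (M.valid a x h)).2 ?_⟩
            rintro rfl
            exact hMa h)
        exact ⟨a', ha', (Matching.partner_eq_iff (I.notMem_of_E ha hE) ha').2 h1, h2⟩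
    · have h1 : I.first a = a := I.best_eq_self fun ⟨b, hb, _⟩ => hex ⟨b, hb⟩
      refine ⟨a, ha, ?_, rfl⟩
      rcases h : M.m a with _ | x
      · simp [Matching.partner, h, h1]
      · exact absurd ⟨x, M.valid a x h⟩ hex
  refine ⟨fun a ha => ?_, hinj, htop⟩
  by_cases hF : ∃ a₀ ∈ I.A, I.first a₀ = M.partner a
  · obtain ⟨a₀, ha₀, e⟩ := hF
    obtain ⟨a', ha', h1, h2⟩ := htop a₀ ha₀
    obtain rfl := hinj a' ha' a ha (h1.trans e)
    exact Or.inl (h1.trans h2.symm)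
  · right
    by_cases hex : ∃ b, I.E a b ∧ ∀ a' ∈ I.A, I.first a' ≠ b
    · have hbest := I.best_spec hex
      change I.IsBest a _ (I.second a) at hbest
      obtain ⟨hE, hnF, hpref⟩ := hbest
      by_contra hne
      obtain ⟨a', ha', -, h2⟩ := hM.first_of_prefers hc hA hB ha hE (by
        rcases h : M.m a with _ | x
        · exact Or.inl rfl
        · have hx : M.partner a = x := by simp [Matching.partner, h]
          rw [hx] at hne hF
          exact Or.inr ⟨x, rfl, hpref x (M.valid a x h)
            (fun a' ha' e => hF ⟨a', ha', e⟩) hne⟩)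
      exact hnF a' ha' h2
    · rw [PMInstance.second, I.best_eq_self hex]
      rcases h : M.m a with _ | x
      · simp [Matching.partner, h]
      · refine absurd ⟨x, M.valid a x h, fun a' ha' e => hF ⟨a', ha', ?_⟩⟩ hex
        simp [Matching.partner, h, e]

theorem differs_partner_iff {b : V} (hb : b ∉ I.A) :
    Differs I.A M.partner M'.partner b ↔ M.m b ≠ M'.m b := by
  have key : ∀ N N' : Matching V I.E, (∃ a ∈ I.A, N.partner a = b ∧ N'.partner a ≠ b) ↔
      ∃ a, N.m b = some a ∧ N'.m b ≠ some a := by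
    intro N N'
    constructor
    · rintro ⟨a, ha, h1, h2⟩
      rw [Matching.partner_eq_iff hb ha] at h1
      rw [Ne, Matching.partner_eq_iff hb ha] at h2
      exact ⟨a, h1, h2⟩
    · rintro ⟨a, h1, h2⟩
      have ha := I.mem_of_E hb (N.valid b a h1)
      refine ⟨a, ha, (Matching.partner_eq_iff hb ha).2 h1, ?_⟩
      rwa [Ne, Matching.partner_eq_iff hb ha]
  rw [Differs, key, key]
  rcases h : M.m b with _ | x <;> rcases h' : M'.m b with _ | y <;> simp [eq_comm]

theorem prefersVx_of_partner_eq_first {a : V} (ha : a ∈ I.A) (hf : M.partner a = I.first a)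
    (hne : M.partner a ≠ M'.partner a) : prefersVx I M M' a := by
  rcases prefersVx_or_of_ne (Matching.partner_ne_iff.1 hne) with h | h
  · exact h
  exfalso
  rcases h with ⟨h1, h2⟩ | ⟨u, u', h1, h2, h3⟩
  · obtain ⟨x, hx⟩ := Option.ne_none_iff_exists'.1 h2
    refine I.notMem_of_E ha (I.first_spec (M'.valid a x hx)).1 ?_
    rw [← hf]
    simpa [Matching.partner, h1] using ha
  · have e1 : M'.partner a = u := by simp [Matching.partner, h1]
    have e2 : M.partner a = u' := by simp [Matching.partner, h2]
    have := (I.first_spec (M'.valid a u h1)).2 (by rw [← hf, ← e1]; exact hne.symm)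
    rw [← hf, e2] at this
    exact I.pref_asymm _ _ _ h3 this

theorem prefersVx_iff_partner {a : V} (ha : a ∈ I.A)
    (ho : IsOrientation I.A I.first I.second M.partner)
    (ho' : IsOrientation I.A I.first I.second M'.partner) :
    prefersVx I M M' a ↔ M.partner a ≠ M'.partner a ∧ M.partner a = I.first a := by
  refine ⟨fun h => ?_, fun h => prefersVx_of_partner_eq_first ha h.2 h.1⟩
  have hne : M.partner a ≠ M'.partner a :=
    Matching.partner_ne_iff.2 fun e => not_prefersVx_of_eq e h
  refine ⟨hne, ?_⟩
  by_contra hf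
  have hf' : M'.partner a = I.first a := by
    have := ho.mem a ha
    have := ho'.mem a ha
    grind
  exact prefersVx_asymm h (prefersVx_of_partner_eq_first ha hf' hne.symm)

/-- The component of the graph joining first to second choices a vertex is involved in. -/
noncomputable def PMInstance.component (I : PMInstance V) (v : V) :
    Quotient (linkSetoid I.A I.first I.second) :=
  if v ∈ I.A then linkClass I.A I.first I.second (I.first v) else linkClass I.A I.first I.second v

theorem component_eq (ho : IsOrientation I.A I.first I.second M.partner) {u v : V}
    (h : M.m u = some v) : I.component u = I.component v := by
  have key : ∀ {u v}, M.m u = some v → u ∈ I.A → I.component u = I.component v := by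
    intro u v h hu
    have hv := I.notMem_of_E hu (M.valid u v h)
    rw [PMInstance.component, PMInstance.component, if_pos hu, if_neg hv, ← ho.linkClass_eq hu,
      Matching.partner, h, Option.getD_some]
  by_cases hu : u ∈ I.A
  · exact key h hu
  · exact (key ((M.msymm u v).1 h) (I.mem_of_E hu (M.valid u v h))).symm

/-- The matching agreeing with `M'` on a component and with `M` elsewhere. -/
noncomputable def hybrid (ho : IsOrientation I.A I.first I.second M.partner)
    (ho' : IsOrientation I.A I.first I.second M'.partner)
    (K : Quotient (linkSetoid I.A I.first I.second)) : Matching V I.E where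
  m v := if I.component v = K then M'.m v else M.m v
  msymm u v := by
    have h1 := M.msymm u v
    have h2 := M'.msymm u v
    have h3 := fun h => component_eq ho (u := u) (v := v) h
    have h4 := fun h => component_eq ho' (u := u) (v := v) h
    by_cases hu : I.component u = K <;> by_cases hv : I.component v = K <;>
      simp only [hu, hv, if_true, if_false] <;> grind
  valid u v := by
    split_ifs
    · exact M'.valid u v
    · exact M.valid u v

theorem prefersVx_congr {N N' : Matching V I.E} {v : V} (h : M.m v = N.m v)
    (h' : M'.m v = N'.m v) : prefersVx I M M' v ↔ prefersVx I N N' v := by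
  simp only [prefersVx, h, h']

theorem sum_component_le (hM : popular I M) (ho : IsOrientation I.A I.first I.second M.partner)
    (ho' : IsOrientation I.A I.first I.second M'.partner)
    (K : Quotient (linkSetoid I.A I.first I.second)) :
    ∑ v with I.component v = K ∧ prefersVx I M' M v, I.w v ≤
      ∑ v with I.component v = K ∧ prefersVx I M M' v, I.w v := by
  have h := hM (hybrid ho ho' K)
  rw [weightPref, weightPref, ← Finset.sum_filter, ← Finset.sum_filter] at h
  have key : ∀ v, (prefersVx I (hybrid ho ho' K) M v ↔
      I.component v = K ∧ prefersVx I M' M v) ∧ (prefersVx I M (hybrid ho ho' K) v ↔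
      I.component v = K ∧ prefersVx I M M' v) := by
    intro v
    by_cases hv : I.component v = K
    · have e : (hybrid ho ho' K).m v = M'.m v := if_pos hv
      exact ⟨by simp [hv, prefersVx_congr e rfl], by simp [hv, prefersVx_congr rfl e]⟩
    · have e : (hybrid ho ho' K).m v = M.m v := if_neg hv
      exact ⟨by simp [hv, not_prefersVx_of_eq e], by simp [hv, not_prefersVx_of_eq e.symm]⟩
  simpa only [key] using h

theorem even_card_component_ne (hM : popular I M) (hM' : popular I M')
    (ho : IsOrientation I.A I.first I.second M.partner)
    (ho' : IsOrientation I.A I.first I.second M'.partner)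
    (hA : ∀ a ∈ I.A, I.w a = c) (hB : ∀ b : V, b ∉ I.A → I.w b = 1)
    (K : Quotient (linkSetoid I.A I.first I.second)) :
    Even (Finset.univ.filter fun v => v ∉ I.A ∧ linkClass I.A I.first I.second v = K ∧
      Differs I.A M.partner M'.partner v).card := by
  have hsum : ∀ {N N' : Matching V I.E}, IsOrientation I.A I.first I.second N.partner →
      IsOrientation I.A I.first I.second N'.partner →
      ∑ v with I.component v = K ∧ prefersVx I N N' v, I.w v =
      ((classEdges I.A I.first I.second K).filter fun a => N.partner a ≠ N'.partner a ∧
        N.partner a = I.first a).card * c +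
      (Finset.univ.filter fun v => v ∉ I.A ∧ linkClass I.A I.first I.second v = K ∧
        prefersVx I N N' v).card := by
    intro N N' hN hN'
    rw [← Finset.sum_filter_add_sum_filter_not _ (fun v => v ∈ I.A), Finset.filter_filter,
      Finset.filter_filter]
    congr 1
    · rw [← nsmul_eq_mul, ← Finset.sum_const]
      refine Finset.sum_congr ?_ fun a ha => hA a (mem_classEdges.1 (Finset.mem_filter.1 ha).1).1
      ext a
      simp only [Finset.mem_filter, Finset.mem_univ, true_and, mem_classEdges]
      constructor
      · rintro ⟨⟨h1, h2⟩, ha⟩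
        rw [PMInstance.component, if_pos ha] at h1
        exact ⟨⟨ha, h1⟩, (prefersVx_iff_partner ha hN hN').1 h2⟩
      · rintro ⟨⟨ha, h1⟩, h2⟩
        refine ⟨⟨?_, (prefersVx_iff_partner ha hN hN').2 h2⟩, ha⟩
        rwa [PMInstance.component, if_pos ha]
    · rw [Finset.card_eq_sum_ones, Nat.cast_sum]
      refine Finset.sum_congr ?_ fun b hb => ?_
      · ext b
        simp only [Finset.mem_filter, Finset.mem_univ, true_and]
        by_cases hb : b ∈ I.A
        · simp [hb]
        · simp [hb, PMInstance.component]
      · simp only [Finset.mem_filter, Finset.mem_univ, true_and] at hb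
        rw [hB b hb.1, Nat.cast_one]
  have heq := le_antisymm (sum_component_le hM ho ho' K) (sum_component_le hM' ho' ho K)
  rw [hsum ho ho', hsum ho' ho] at heq
  have htop : ((classEdges I.A I.first I.second K).filter fun a =>
      M.partner a ≠ M'.partner a ∧ M.partner a = I.first a).card =
      ((classEdges I.A I.first I.second K).filter fun a =>
        M.partner a ≠ M'.partner a ∧ M'.partner a = I.first a).card := by
    convert ho.card_filter_top_eq ho' K
  simp only [ne_comm (a := M'.partner _)] at heq
  rw [htop, add_left_cancel_iff, Nat.cast_inj] at heq
  refine ⟨_, Eq.trans ?_ (congrArg (_ + ·) heq)⟩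
  rw [← Finset.card_union_of_disjoint]
  · congr 1
    ext b
    simp only [Finset.mem_filter, Finset.mem_univ, true_and, Finset.mem_union]
    by_cases hb : b ∈ I.A
    · simp [hb]
    · rw [differs_partner_iff hb]
      have h1 := prefersVx_or_of_ne (M := M) (M' := M') (v := b)
      have h2 := not_prefersVx_of_eq (M := M) (M' := M') (v := b)
      have h3 := not_prefersVx_of_eq (M := M') (M' := M) (v := b)
      constructor
      · rintro ⟨h4, h5, h6⟩
        rcases h1 h6 with h | h
        · exact Or.inl ⟨h4, h5, h⟩
        · exact Or.inr ⟨h4, h5, h⟩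
      · rintro (⟨h4, h5, h⟩ | ⟨h4, h5, h⟩)
        · exact ⟨h4, h5, fun e => h2 e h⟩
        · exact ⟨h4, h5, fun e => h3 e.symm h⟩
  · rw [Finset.disjoint_left]
    simp only [Finset.mem_filter]
    exact fun b h1 h2 => prefersVx_asymm h1.2.2.2 h2.2.2.2

theorem m_eq_of_agree (ho : IsOrientation I.A I.first I.second M.partner)
    (ho' : IsOrientation I.A I.first I.second M'.partner)
    {K : Quotient (linkSetoid I.A I.first I.second)}
    (h : ∀ a ∈ classEdges I.A I.first I.second K, M.partner a = M'.partner a) {v : V}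
    (hv : I.component v = K) : M.m v = M'.m v := by
  by_cases hA : v ∈ I.A
  · rw [PMInstance.component, if_pos hA] at hv
    by_contra hne
    exact Matching.partner_ne_iff.2 hne (h v (mem_classEdges.2 ⟨hA, hv⟩))
  · rw [PMInstance.component, if_neg hA] at hv
    by_contra hne
    rcases (differs_partner_iff hA).2 hne with ⟨a, ha, rfl, hne'⟩ | ⟨a, ha, rfl, hne'⟩
    · rw [ho.linkClass_eq ha] at hv
      exact hne' (h a (mem_classEdges.2 ⟨ha, hv⟩)).symm
    · rw [ho'.linkClass_eq ha] at hv
      exact hne' (h a (mem_classEdges.2 ⟨ha, hv⟩))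

theorem four_le_card_component (hM : popular I M) (hM' : popular I M')
    (ho : IsOrientation I.A I.first I.second M.partner)
    (ho' : IsOrientation I.A I.first I.second M'.partner)
    (hA : ∀ a ∈ I.A, I.w a = c) (hB : ∀ b : V, b ∉ I.A → I.w b = 1) {a : V} (ha : a ∈ I.A)
    (hne : M.partner a ≠ M'.partner a) :
    4 ≤ (Finset.univ.filter fun v => I.component v = I.component a).card := by
  have hac : I.component a = linkClass I.A I.first I.second (I.first a) := by
    rw [PMInstance.component, if_pos ha]
  set K := I.component a
  have h1 := ho.even_card_ne ho' K
  have h2 := even_card_component_ne hM hM' ho ho' hA hB K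
  have h1' : 0 < ((classEdges I.A I.first I.second K).filter fun a =>
      M.partner a ≠ M'.partner a).card :=
    Finset.card_pos.2 ⟨a, Finset.mem_filter.2 ⟨mem_classEdges.2 ⟨ha, hac.symm⟩, hne⟩⟩
  have hb : ∃ b, b ∉ I.A ∧ I.component b = K ∧ M.m b ≠ M'.m b := by
    have hm := Matching.partner_ne_iff.1 hne
    rcases h : M.m a with _ | b
    · rcases h' : M'.m a with _ | b
      · exact absurd (h.trans h'.symm) hm
      · refine ⟨b, I.notMem_of_E ha (M'.valid a b h'), (component_eq ho' h').symm, fun e => ?_⟩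
        rw [(M'.msymm a b).1 h', M.msymm, h] at e
        simp at e
    · refine ⟨b, I.notMem_of_E ha (M.valid a b h), (component_eq ho h).symm, fun e => hm ?_⟩
      rw [(M.msymm a b).1 h] at e
      rw [h, (M'.msymm a b).2 e.symm]
  obtain ⟨b, hbA, hbK, hbne⟩ := hb
  have h2' : 0 < (Finset.univ.filter fun v => v ∉ I.A ∧
      linkClass I.A I.first I.second v = K ∧ Differs I.A M.partner M'.partner v).card := by
    refine Finset.card_pos.2 ⟨b, Finset.mem_filter.2 ⟨Finset.mem_univ b, hbA, ?_,
      (differs_partner_iff hbA).2 hbne⟩⟩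
    rwa [PMInstance.component, if_neg hbA] at hbK
  have hle : ((classEdges I.A I.first I.second K).filter fun a =>
      M.partner a ≠ M'.partner a).card + (Finset.univ.filter fun v => v ∉ I.A ∧
      linkClass I.A I.first I.second v = K ∧ Differs I.A M.partner M'.partner v).card ≤
      (Finset.univ.filter fun v => I.component v = K).card := by
    rw [← Finset.card_union_of_disjoint]
    · refine Finset.card_le_card fun v hv => ?_
      simp only [Finset.mem_union, Finset.mem_filter, mem_classEdges, Finset.mem_univ,
        true_and] at hv ⊢
      rcases hv with ⟨⟨hvA, hvK⟩, -⟩ | ⟨hvA, hvK, -⟩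
      · rwa [PMInstance.component, if_pos hvA]
      · rwa [PMInstance.component, if_neg hvA]
    · rw [Finset.disjoint_left]
      simp only [Finset.mem_filter, mem_classEdges]
      exact fun v hv hv' => hv'.2.1 hv.1.1
  have h3 : Even ((classEdges I.A I.first I.second K).filter fun a =>
      M.partner a ≠ M'.partner a).card := by
    convert h1
  obtain ⟨x, hx⟩ := h3
  obtain ⟨y, hy⟩ := h2
  omega

/-- The part of a matching inside a component. -/
noncomputable def restriction (K : Quotient (linkSetoid I.A I.first I.second))
    (M : Matching V I.E) : V → Option V :=
  fun v => if I.component v = K then M.m v else none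

theorem restriction_eq {K : Quotient (linkSetoid I.A I.first I.second)}
    (ho : IsOrientation I.A I.first I.second M.partner)
    (ho' : IsOrientation I.A I.first I.second M'.partner)
    (h : ∀ a ∈ classEdges I.A I.first I.second K, M.partner a = M'.partner a) :
    restriction K M = restriction K M' := by
  funext v
  by_cases hv : I.component v = K
  · simp only [restriction, if_pos hv, m_eq_of_agree ho ho' h hv]
  · simp only [restriction, if_neg hv]

instance : Finite (Matching V I.E) :=
  Finite.of_injective (fun M : Matching V I.E => M.m) fun _ _ h => Matching.ext_m (congrFun h)

theorem card_image_restriction_pow_le (hc : 3 < c) (hA : ∀ a ∈ I.A, I.w a = c)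
    (hB : ∀ b : V, b ∉ I.A → I.w b = 1) {S : Finset (Matching V I.E)}
    (hS : ∀ M ∈ S, popular I M) (K : Quotient (linkSetoid I.A I.first I.second)) :
    (S.image (restriction K)).card ^ 4 ≤
      2 ^ (Finset.univ.filter fun v => I.component v = K).card := by
  have ho := fun M hM => (hS M hM).isOrientation hc hA hB
  have hself : ∀ a ∈ I.A, (I.first a ∈ I.A → I.first a = a) ∧
      (I.second a ∈ I.A → I.second a = a) :=
    fun a ha => ⟨I.self_of_mem ha _, I.self_of_mem ha _⟩
  have htwo : (S.image (restriction K)).card ≤ 2 := by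
    by_contra! hlt
    obtain ⟨x, hx, y, hy, z, hz, hxy, hxz, hyz⟩ := Finset.two_lt_card.1 hlt
    obtain ⟨M₁, h₁, rfl⟩ := Finset.mem_image.1 hx
    obtain ⟨M₂, h₂, rfl⟩ := Finset.mem_image.1 hy
    obtain ⟨M₃, h₃, rfl⟩ := Finset.mem_image.1 hz
    have heven : ∀ M ∈ S, ∀ M' ∈ S, Even (Finset.univ.filter fun v => v ∉ I.A ∧
        linkClass I.A I.first I.second v = K ∧ Differs I.A M.partner M'.partner v).card :=
      fun M hM M' hM' =>
        even_card_component_ne (hS M hM) (hS M' hM') (ho M hM) (ho M' hM') hA hB K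
    rcases (ho M₁ h₁).agree_of_even (ho M₂ h₂) (ho M₃ h₃) hself (K := K)
      (by convert heven M₁ h₁ M₂ h₂) (by convert heven M₁ h₁ M₃ h₃)
      (by convert heven M₂ h₂ M₃ h₃) with h | h | h
    · exact hxy (restriction_eq (ho _ h₁) (ho _ h₂) h)
    · exact hxz (restriction_eq (ho _ h₁) (ho _ h₃) h)
    · exact hyz (restriction_eq (ho _ h₂) (ho _ h₃) h)
  by_cases hone : (S.image (restriction K)).card ≤ 1
  · calc (S.image (restriction K)).card ^ 4 ≤ 1 ^ 4 := Nat.pow_le_pow_left hone 4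
      _ ≤ _ := by simpa using Nat.one_le_two_pow
  · obtain ⟨x, hx, y, hy, hxy⟩ := Finset.one_lt_card.1 (not_le.1 hone)
    obtain ⟨M₁, h₁, rfl⟩ := Finset.mem_image.1 hx
    obtain ⟨M₂, h₂, rfl⟩ := Finset.mem_image.1 hy
    have hex : ∃ a ∈ classEdges I.A I.first I.second K, M₁.partner a ≠ M₂.partner a := by
      by_contra! hcon
      exact hxy (restriction_eq (ho _ h₁) (ho _ h₂) hcon)
    obtain ⟨a, ha, hne⟩ := hex
    rw [mem_classEdges] at ha
    have h4 := four_le_card_component (hS _ h₁) (hS _ h₂) (ho _ h₁) (ho _ h₂) hA hB ha.1 hne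
    have hK : I.component a = K := by rw [PMInstance.component, if_pos ha.1, ha.2]
    rw [hK] at h4
    exact (Nat.pow_le_pow_left htwo 4).trans (Nat.pow_le_pow_right two_pos h4)

theorem card_pow_four_le (hc : 3 < c) (hA : ∀ a ∈ I.A, I.w a = c)
    (hB : ∀ b : V, b ∉ I.A → I.w b = 1) {S : Finset (Matching V I.E)}
    (hS : ∀ M ∈ S, popular I M) : S.card ^ 4 ≤ 2 ^ Fintype.card V := by
  have : Finite (Quotient (linkSetoid I.A I.first I.second)) := Quotient.finite _
  have := Fintype.ofFinite (Quotient (linkSetoid I.A I.first I.second))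
  have hcard : S.card ≤ (Fintype.piFinset fun K => S.image (restriction K)).card := by
    refine Finset.card_le_card_of_injOn (fun M K => restriction K M)
      (fun M hM => ?_) fun M _ M' _ e => ?_
    · simp only [Finset.mem_coe, Fintype.mem_piFinset]
      exact fun K => Finset.mem_image_of_mem _ hM
    · refine Matching.ext_m fun v => ?_
      have := congrFun (congrFun e (I.component v)) v
      simpa [restriction] using this
  rw [Fintype.card_piFinset] at hcard
  calc S.card ^ 4 ≤ (∏ K, (S.image (restriction K)).card) ^ 4 := Nat.pow_le_pow_left hcard 4
    _ = ∏ K, (S.image (restriction K)).card ^ 4 := (Finset.prod_pow _ _ _).symm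
    _ ≤ ∏ K, 2 ^ (Finset.univ.filter fun v => I.component v = K).card :=
        Finset.prod_le_prod' fun K _ => card_image_restriction_pow_le hc hA hB hS K
    _ = 2 ^ Fintype.card V := by
        rw [Finset.prod_pow_eq_pow_sum]
        congr 1
        exact (Finset.card_eq_sum_card_fiberwise fun v _ => Finset.mem_univ (I.component v)).symm

end Popular

/-- With `w(a) = c > 3` on `A` and `w(b) = 1` on `B`, there are at most
`2^{n/4}` popular matchings. -/
theorem card_popular_matchings_le (I : PMInstance V) (c : ℚ) (hc : 3 < c)
    (hA : ∀ a ∈ I.A, I.w a = c) (hB : ∀ b : V, b ∉ I.A → I.w b = 1) :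
    (({ M : Matching V I.E | popular I M }.ncard : ℝ)) ≤
      (2 : ℝ) ^ ((Fintype.card V : ℝ) / 4) := by
  have hfin : { M : Matching V I.E | popular I M }.Finite := Set.toFinite _
  have h := card_pow_four_le hc hA hB (S := hfin.toFinset) fun M hM => by simpa using hM
  rw [Set.ncard_eq_toFinset_card _ hfin]
  refine le_of_pow_le_pow_left₀ four_ne_zero (Real.rpow_nonneg two_pos.le _) ?_
  rw [← Real.rpow_mul_natCast two_pos.le, Nat.cast_ofNat, div_mul_cancel₀ _ four_ne_zero,
    Real.rpow_natCast]
  exact_mod_cast h
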